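/- For every nonnegative integer m, ζ(m+3) = (2^{m+1} / ((m+1)(m+2)(2^{m+3}-1))) · Σ_{n=1}^∞ 2^{2n} H_{n-1} P_m(O_n^{(1)}, ..., O_n^{(m)}) / (n^2 C(2n,n)). -/

import Mathlib

/-- The modified Bell polynomials, defined by the generating function
`exp (∑_{k≥1} x_k z^k / k) = ∑_{m≥0} P_m(x_1,…,x_m) z^m`, via the
equivalent recursion `(m+1) P_{m+1} = ∑_{k=1}^{m+1} x_k P_{m+1-k}`. -/
noncomputable def modifiedBell (x : ℕ → ℝ) : ℕ → ℝ
  | 0 => 1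
  | (m + 1) => ((m : ℝ) + 1)⁻¹ *
      ∑ k ∈ Finset.range (m + 1), x (k + 1) * modifiedBell x (m - k)
  decreasing_by omega

/-- Harmonic number `H_n = ∑_{j=1}^n 1/j` (with `H_0 = 0`). -/
noncomputable def harmonicNum (n : ℕ) : ℝ := ∑ j ∈ Finset.Icc 1 n, 1 / (j : ℝ)

/-- Odd harmonic number of order `s`: `O_n^{(s)} = ∑_{k=1}^n 1/(2k-1)^s`. -/
noncomputable def oddHarmonicPow (n s : ℕ) : ℝ :=
  ∑ k ∈ Finset.Icc 1 n, 1 / (2 * (k : ℝ) - 1) ^ s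

open Finset Filter Topology

lemma hN_succ (n : ℕ) : harmonicNum (n+1) = harmonicNum n + 1/((n:ℝ)+1) := by
  unfold harmonicNum
  rw [Finset.sum_Icc_succ_top (by omega)]
  push_cast; rfl

lemma hN_zero : harmonicNum 0 = 0 := by simp [harmonicNum]

lemma hN_nonneg (n : ℕ) : 0 ≤ harmonicNum n := by
  unfold harmonicNum; positivity

lemma hN_ge (n : ℕ) : 1 ≤ harmonicNum (n+1) := by
  induction n with
  | zero => rw [hN_succ, hN_zero]; norm_num
  | succ n ih => rw [hN_succ]; have : 0 ≤ 1/(((n+1:ℕ):ℝ)+1) := by positivity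
                 linarith

noncomputable def uu (a : ℝ) : ℕ → ℝ
  | 0 => 1/a
  | (n+1) => uu a n * ((n+1)/(a+n+1))

lemma uu_pos {a : ℝ} (ha : 0 < a) (n : ℕ) : 0 < uu a n := by
  induction n with
  | zero => simp [uu, ha]
  | succ n ih => unfold uu; positivity

lemma uu_shift {a : ℝ} (ha : 0 < a) (n : ℕ) : uu (a+1) n = uu a n * (a/(a+n+1)) := by
  induction n with
  | zero => simp [uu]; field_simp
  | succ n ih =>
    simp only [uu]; rw [ih]; push_cast
    have : a + n + 1 ≠ 0 := by positivity
    have : a + 1 + n + 1 ≠ 0 := by positivity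
    have : a + (n + 1) + 1 ≠ 0 := by positivity
    field_simp
    ring

lemma uu_le {b : ℝ} (hb : 1 ≤ b) (n : ℕ) : uu b n ≤ 1/b * (1/((n:ℝ)+1)) := by
  induction n with
  | zero => simp [uu]
  | succ n ih =>
    simp only [uu]; push_cast
    calc uu b n * (((n:ℝ)+1)/(b+n+1)) ≤ (1/b * (1/((n:ℝ)+1))) * (((n:ℝ)+1)/(1+n+1)) := by
          gcongr
      _ = _ := by field_simp; ring

noncomputable def ss (a : ℝ) (n : ℕ) : ℝ := harmonicNum n * uu a n / ((n:ℝ)+1)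

noncomputable def WW (a : ℝ) (n : ℕ) : ℝ := (harmonicNum n * uu a n + uu a n / a) / a

lemma ss_nonneg {a : ℝ} (ha : 0 < a) (n : ℕ) : 0 ≤ ss a n := by
  have := hN_nonneg n
  have := uu_pos ha n
  unfold ss; positivity

lemma WW_nonneg {a : ℝ} (ha : 0 < a) (n : ℕ) : 0 ≤ WW a n := by
  have := hN_nonneg n
  have := uu_pos ha n
  unfold WW; positivity

lemma ss_sub {a : ℝ} (ha : 0 < a) (n : ℕ) : ss a n - ss (a+1) n = WW a n - WW a (n+1) := by
  unfold ss WW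
  rw [uu_shift ha, hN_succ]
  simp only [uu]
  field_simp
  ring

lemma hsum : Summable (fun n : ℕ => harmonicNum n / ((n:ℝ)+1)^2) := by
  apply summable_of_sum_range_le (c := 4)
  · intro n; have := hN_nonneg n; positivity
  · intro N
    have h : ∀ n : ℕ, harmonicNum n / ((n:ℝ)+1)^2 ≤
        2 * (harmonicNum n + 2)/((n:ℝ)+1) - 2 * (harmonicNum (n+1) + 2)/(((n+1:ℕ):ℝ)+1) := by
      intro n
      have h0 := hN_nonneg n
      rw [hN_succ]
      have e : 2 * (harmonicNum n + 2)/((n:ℝ)+1) - 2 * (harmonicNum n + 1/((n:ℝ)+1) + 2)/(((n+1:ℕ):ℝ)+1) = 2 * (harmonicNum n + 1) / (((n:ℝ)+1)*((n:ℝ)+2)) := by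
        push_cast
        have : (n:ℝ)+1+1 ≠ 0 := by positivity
        field_simp
        ring
      rw [e, div_le_div_iff₀ (by positivity) (by positivity)]
      have hn : (0:ℝ) ≤ n := by positivity
      have h1 : (n:ℝ)+2 ≤ 2*((n:ℝ)+1) := by linarith
      have h2 : harmonicNum n * (((n:ℝ)+1)*((n:ℝ)+2)) ≤ harmonicNum n * (((n:ℝ)+1)*(2*((n:ℝ)+1))) := by gcongr
      have h3 : 0 ≤ ((n:ℝ)+1)^2 := by positivity
      nlinarith
    calc _ ≤ ∑ n ∈ range N, (2 * (harmonicNum n + 2)/((n:ℝ)+1) - 2 * (harmonicNum (n+1) + 2)/(((n+1:ℕ):ℝ)+1)) := Finset.sum_le_sum fun n _ => h n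
      _ = _ := Finset.sum_range_sub' (fun n : ℕ => 2 * (harmonicNum n + 2)/((n:ℝ)+1)) N
      _ ≤ 4 := by
        have := hN_nonneg N
        have : 0 ≤ 2 * (harmonicNum N + 2)/((N:ℝ)+1) := by positivity
        simp [hN_zero] at *
        linarith

lemma ss_le {b : ℝ} (hb : 1 ≤ b) (n : ℕ) : ss b n ≤ 1/b * (harmonicNum n / ((n:ℝ)+1)^2) := by
  unfold ss
  have := hN_nonneg n
  calc _ ≤ harmonicNum n * (1/b * (1/((n:ℝ)+1))) / ((n:ℝ)+1) := by
        gcongr; exact uu_le hb n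
    _ = _ := by field_simp

lemma ss_summable_one {b : ℝ} (hb : 1 ≤ b) : Summable (ss b) :=
  Summable.of_nonneg_of_le (ss_nonneg (by linarith)) (ss_le hb) (hsum.mul_left _)

lemma WW_anti {a : ℝ} (ha : 0 < a) : Antitone (WW a) := by
  apply antitone_nat_of_succ_le
  intro n
  have h := ss_sub ha n
  have : ss (a+1) n ≤ ss a n := by
    unfold ss
    rw [uu_shift ha]
    have h1 := uu_pos ha n
    have h2 := hN_nonneg n
    have : uu a n * (a/(a+n+1)) ≤ uu a n * 1 := by
      gcongr
      rw [div_le_one (by positivity)]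
      have : (0:ℝ) ≤ n := by positivity
      linarith
    gcongr
    simpa using this
  linarith

lemma ss_summable {a : ℝ} (ha : 0 < a) : Summable (ss a) := by
  have h1 := ss_summable_one (b := a+1) (by linarith)
  have h2 : Summable (fun n => WW a n - WW a (n+1)) := by
    apply summable_of_sum_range_le (c := WW a 0)
    · intro n; have := WW_anti ha (Nat.le_succ n); simpa using this
    · intro N
      rw [Finset.sum_range_sub']
      have := WW_nonneg ha N
      linarith
  refine (h1.add h2).congr fun n => ?_
  rw [← ss_sub ha]; ring

lemma WW_tendsto {a : ℝ} (ha : 0 < a) : Tendsto (WW a) atTop (𝓝 0) := by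
  have hb : BddBelow (Set.range (WW a)) := ⟨0, by rintro _ ⟨n, rfl⟩; exact WW_nonneg ha n⟩
  have ht := tendsto_atTop_ciInf (WW_anti ha) hb
  set L := ⨅ n, WW a n with hL
  have hL0 : 0 ≤ L := le_ciInf (WW_nonneg ha)
  rcases hL0.eq_or_lt with h | h
  · rwa [← h] at ht
  exfalso
  have hle : ∀ n, L ≤ WW a n := fun n => ciInf_le hb n
  have hs : Summable (fun n : ℕ => L * (1/((n+1+1:ℕ):ℝ))) := by
    have h1 := ((summable_nat_add_iff 1).2 (ss_summable ha)).mul_left ((1+1/a)/a)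
    refine Summable.of_nonneg_of_le (fun n => by positivity) (fun n => ?_) h1
    calc L * (1/((n+1+1:ℕ):ℝ)) ≤ WW a (n+1) * (1/((n+1+1:ℕ):ℝ)) := by gcongr; exact hle _
      _ ≤ ((harmonicNum (n+1) * uu a (n+1) + harmonicNum (n+1) * uu a (n+1) / a) / a) * (1/((n+1+1:ℕ):ℝ)) := by
        unfold WW
        have := uu_pos ha (n+1)
        have := hN_ge n
        gcongr
        nlinarith
      _ = _ := by unfold ss; push_cast; field_simp
  rw [summable_mul_left_iff h.ne'] at hs
  have := (summable_nat_add_iff (f := fun n : ℕ => 1/(n:ℝ)) 2).1 hs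
  exact Real.not_summable_one_div_natCast this

noncomputable def SS (a : ℝ) : ℝ := ∑' n, ss a n

lemma SS_sub {a : ℝ} (ha : 0 < a) : SS a - SS (a+1) = 1/a^3 := by
  have h1 := (ss_summable ha).hasSum.sub (ss_summable (a := a+1) (by linarith)).hasSum
  have h2 := h1.tendsto_sum_nat
  simp_rw [ss_sub ha, Finset.sum_range_sub'] at h2
  have h3 := tendsto_nhds_unique h2 ((WW_tendsto ha).const_sub (WW a 0))
  unfold SS
  rw [h3]; simp [WW, hN_zero, uu]; field_simp

lemma SS_hasSum {a : ℝ} (ha : 0 < a) : HasSum (fun j : ℕ => 1/(a+j)^3) (SS a) := by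
  rw [hasSum_iff_tendsto_nat_of_nonneg (fun j => by positivity)]
  have h : ∀ N : ℕ, ∑ j ∈ range N, 1/(a+j)^3 = SS a - SS (a+N) := by
    intro N
    induction N with
    | zero => simp
    | succ N ih =>
      rw [sum_range_succ, ih, ← SS_sub (by positivity)]; push_cast; ring_nf
  simp_rw [h]
  suffices Tendsto (fun N : ℕ => SS (a+N)) atTop (𝓝 0) by simpa using this.const_sub (SS a)
  set K := ∑' n : ℕ, harmonicNum n / ((n:ℝ)+1)^2 with hK
  have ht : Tendsto (fun N : ℕ => 1/(a+N) * K) atTop (𝓝 0) := by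
    have : Tendsto (fun N : ℕ => a + (N:ℝ)) atTop atTop :=
      tendsto_atTop_add_const_left _ _ tendsto_natCast_atTop_atTop
    simpa using (this.inv_tendsto_atTop).mul_const K
  refine squeeze_zero' (Eventually.of_forall fun N => tsum_nonneg (ss_nonneg (by positivity))) ?_ ht
  filter_upwards [eventually_ge_atTop 1] with N hN
  have hb : 1 ≤ a + N := by
    have : (1:ℝ) ≤ N := by exact_mod_cast hN
    linarith
  unfold SS
  rw [hK, ← tsum_mul_left]
  exact (ss_summable_one hb).tsum_le_tsum (ss_le hb) (hsum.mul_left _)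

lemma swap_lem (d : ℕ → ℕ → ℝ) (hd : ∀ n m, 0 ≤ d n m) (E : ℕ → ℝ → ℝ) (G : ℝ → ℝ)
    (h1 : ∀ z, |z| < 1 → ∀ n, HasSum (fun m => d n m * z^m) (E n z))
    (h2 : ∀ z, |z| < 1 → HasSum (fun n => E n z) (G z)) (z : ℝ) (hz : |z| < 1) :
    HasSum (fun m => (∑' n, d n m) * z^m) (G z) := by
  have hs : ∀ z, |z| < 1 → Summable (fun p : ℕ × ℕ => d p.1 p.2 * z^p.2) := by
    intro z hz
    rw [← summable_norm_iff]
    have hz' : |(|z|)| < 1 := by simpa using hz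
    rw [summable_prod_of_nonneg (fun p => norm_nonneg _)]
    have e : ∀ n m, ‖d n m * z^m‖ = d n m * |z|^m := by
      intro n m; rw [norm_mul, norm_pow, Real.norm_eq_abs, Real.norm_eq_abs, abs_of_nonneg (hd n m)]
    simp only [e]
    refine ⟨fun n => (h1 _ hz' n).summable, ?_⟩
    simp_rw [(h1 _ hz' _).tsum_eq]
    exact (h2 _ hz').summable
  have a1 := (hs z hz).hasSum
  have a2 := a1.prod_fiberwise (h1 z hz)
  have a3 : HasSum (fun p : ℕ × ℕ => d p.1 p.2 * z^p.2) (G z) := by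
    rwa [a2.unique (h2 z hz)] at a1
  have a4 : HasSum (fun p : ℕ × ℕ => d p.2 p.1 * z^p.1) (G z) := by
    rw [← (Equiv.prodComm ℕ ℕ).hasSum_iff]
    exact a3
  have a5 := a4.prod_fiberwise (fun m => (a4.summable.prod_factor m).hasSum)
  simpa only [tsum_mul_right] using a5

lemma uniq_lem (p q : ℕ → ℝ) (G : ℝ → ℝ)
    (hp : ∀ z, |z| < 1 → HasSum (fun m => p m * z^m) (G z))
    (hq : ∀ z, |z| < 1 → HasSum (fun m => q m * z^m) (G z)) : p = q := by
  have key : ∀ p : ℕ → ℝ, (∀ z, |z| < 1 → HasSum (fun m => p m * z^m) (G z)) →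
      HasFPowerSeriesAt G (FormalMultilinearSeries.ofScalars ℝ p) 0 := by
    intro p hp
    rw [hasFPowerSeriesAt_iff]
    filter_upwards [Metric.ball_mem_nhds (0:ℝ) one_pos] with z hz
    have := hp z (by simpa using hz)
    simpa [FormalMultilinearSeries.coeff_ofScalars, mul_comm] using this
  have := (key p hp).eq_formalMultilinearSeries (key q hq)
  funext n
  have h := congrArg (fun s => FormalMultilinearSeries.coeff s n) this
  simpa [FormalMultilinearSeries.coeff_ofScalars] using h

lemma geo_mul (r : ℝ) : (1 - PowerSeries.C r * PowerSeries.X) * PowerSeries.mk (fun k => r^k) = 1 := by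
  ext n
  rw [sub_mul, one_mul, mul_assoc, map_sub, PowerSeries.coeff_C_mul]
  cases n with
  | zero => simp
  | succ n => rw [PowerSeries.coeff_succ_X_mul]; simp [PowerSeries.coeff_one, pow_succ']

lemma bell_deriv (x : ℕ → ℝ) : PowerSeries.derivative ℝ (PowerSeries.mk (modifiedBell x)) =
    PowerSeries.mk (fun k => x (k+1)) * PowerSeries.mk (modifiedBell x) := by
  ext m
  rw [PowerSeries.coeff_derivative, PowerSeries.coeff_mk, PowerSeries.coeff_mul, modifiedBell,
    Finset.Nat.sum_antidiagonal_eq_sum_range_succ_mk]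
  simp only [PowerSeries.coeff_mk]
  field_simp

lemma bell_uniq (x : ℕ → ℝ) (h : PowerSeries ℝ) (h0 : PowerSeries.coeff 0 h = 1)
    (hd : PowerSeries.derivative ℝ h = PowerSeries.mk (fun k => x (k+1)) * h) :
    h = PowerSeries.mk (modifiedBell x) := by
  ext m
  rw [PowerSeries.coeff_mk]
  induction m using Nat.strong_induction_on with
  | _ m ih =>
    cases m with
    | zero => rw [h0, modifiedBell]
    | succ m =>
      have := congrArg (PowerSeries.coeff m) hd
      rw [PowerSeries.coeff_derivative, PowerSeries.coeff_mul,
        Finset.Nat.sum_antidiagonal_eq_sum_range_succ_mk] at this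
      rw [modifiedBell]
      simp only [PowerSeries.coeff_mk] at this
      rw [eq_inv_mul_iff_mul_eq₀ (by positivity), mul_comm, this]
      refine Finset.sum_congr rfl fun k _ => ?_
      rw [ih _ (by omega)]

lemma bell_step (x y : ℕ → ℝ) (r : ℝ) (hxy : ∀ k, y (k+1) = x (k+1) + r^(k+1)) :
    PowerSeries.mk (modifiedBell y) =
      PowerSeries.mk (modifiedBell x) * PowerSeries.mk (fun k => r^k) := by
  have hY : PowerSeries.mk (fun k => y (k+1)) = PowerSeries.mk (fun k => x (k+1)) +
      PowerSeries.C r * PowerSeries.mk (fun k => r^k) := by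
    ext k; simp [hxy, pow_succ']
  have hg := geo_mul r
  have : (1 - PowerSeries.C r * PowerSeries.X) * PowerSeries.mk (modifiedBell y) =
      PowerSeries.mk (modifiedBell x) := by
    apply bell_uniq
    · simp [modifiedBell]
    · rw [Derivation.leibniz, bell_deriv y, hY]
      simp only [map_sub, Derivation.leibniz, PowerSeries.derivative_C, PowerSeries.derivative_X,
        smul_eq_mul, Derivation.map_one_eq_zero]
      linear_combination (PowerSeries.C r * PowerSeries.mk (modifiedBell y)) * hg
  rw [← this]
  linear_combination (-PowerSeries.mk (modifiedBell y)) * hg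

lemma bell_zero : ∀ m, modifiedBell (fun k => oddHarmonicPow 0 k) m = if m = 0 then 1 else 0 := by
  intro m
  cases m with
  | zero => simp [modifiedBell]
  | succ m => simp [modifiedBell, oddHarmonicPow]

lemma bell_nonneg (x : ℕ → ℝ) (hx : ∀ k, 0 ≤ x k) (m : ℕ) : 0 ≤ modifiedBell x m := by
  induction m using Nat.strong_induction_on with
  | _ m ih =>
    cases m with
    | zero => simp [modifiedBell]
    | succ m =>
      rw [modifiedBell]
      refine mul_nonneg (by positivity) (Finset.sum_nonneg fun k _ => mul_nonneg (hx _) (ih _ (by omega)))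

lemma odd_nonneg (n k : ℕ) : 0 ≤ oddHarmonicPow n k := by
  unfold oddHarmonicPow
  refine Finset.sum_nonneg fun j hj => ?_
  have : (1:ℝ) ≤ j := by exact_mod_cast (Finset.mem_Icc.1 hj).1
  have : 0 ≤ 2 * (j:ℝ) - 1 := by linarith
  positivity

lemma bell_hasSum (n : ℕ) (z : ℝ) (hz : |z| < 1) :
    (Summable fun m => ‖modifiedBell (fun k => oddHarmonicPow n k) m * z^m‖) ∧
    ∑' m, modifiedBell (fun k => oddHarmonicPow n k) m * z^m =
      ∏ k ∈ range n, (1 - z/(2*(k:ℝ)+1))⁻¹ := by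
  induction n with
  | zero =>
    simp only [bell_zero]
    constructor
    · apply summable_of_hasFiniteSupport
      apply Set.Finite.subset (Set.finite_singleton 0)
      intro m hm
      by_contra h
      simp at h
      simp [h] at hm
    · rw [tsum_eq_single 0]
      · simp
      · intro m hm; simp [hm]
  | succ n ih =>
    obtain ⟨ih1, ih2⟩ := ih
    set r : ℝ := 1/(2*(n:ℝ)+1) with hr
    have hr1 : |z * r| < 1 := by
      rw [abs_mul, hr, abs_of_nonneg (a := 1/(2*(n:ℝ)+1)) (by positivity)]
      have : 1/(2*(n:ℝ)+1) ≤ 1 := by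
        rw [div_le_one (by positivity)]
        have : (0:ℝ) ≤ n := by positivity
        linarith
      have h0 := abs_nonneg z
      have h1 : 0 ≤ 1/(2*(n:ℝ)+1) := by positivity
      nlinarith
    have hst := bell_step (fun k => oddHarmonicPow n k) (fun k => oddHarmonicPow (n+1) k) r (by
      intro k
      simp only [oddHarmonicPow]
      rw [Finset.sum_Icc_succ_top (by omega), hr, div_pow, one_pow]
      push_cast; ring_nf)
    have hc : ∀ m, modifiedBell (fun k => oddHarmonicPow (n+1) k) m * z^m =
        ∑ p ∈ antidiagonal m, (modifiedBell (fun k => oddHarmonicPow n k) p.1 * z^p.1) * (z*r)^p.2 := by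
      intro m
      have := congrArg (PowerSeries.coeff m) hst
      rw [PowerSeries.coeff_mk, PowerSeries.coeff_mul] at this
      simp only [PowerSeries.coeff_mk] at this
      rw [this, Finset.sum_mul]
      refine Finset.sum_congr rfl fun p hp => ?_
      rw [← Finset.HasAntidiagonal.mem_antidiagonal.1 hp, pow_add, mul_pow]; ring
    have hg : Summable fun m : ℕ => ‖(z*r)^m‖ := by
      simp_rw [norm_pow]
      exact summable_geometric_of_lt_one (norm_nonneg _) hr1
    simp only [hc]
    have k1 := summable_norm_sum_mul_antidiagonal_of_summable_norm ih1 hg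
    have k2 := tsum_mul_tsum_eq_tsum_sum_antidiagonal_of_summable_norm ih1 hg
    refine ⟨k1, k2.symm.trans ?_⟩
    rw [ih2, tsum_geometric_of_abs_lt_one hr1, prod_range_succ, hr]
    congr 3
    ring

lemma binom_uu (n : ℕ) (z : ℝ) (hz : |z| < 1) :
    (2:ℝ)^(2*(n+1)) / (((n:ℝ)+1) * (Nat.choose (2*(n+1)) (n+1))) *
      ∏ k ∈ range (n+1), (1 - z/(2*(k:ℝ)+1))⁻¹ = uu ((1-z)/2) n := by
  have hz1 := (abs_lt.1 hz).2
  have hp : ∀ k : ℕ, 0 < 2*(k:ℝ)+1 - z := by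
    intro k
    have : (0:ℝ) ≤ k := by positivity
    linarith
  induction n with
  | zero =>
    have := hp 0
    simp [uu, Nat.choose]
    norm_num [div_eq_mul_inv]
  | succ n ih =>
    rw [prod_range_succ, uu, ← ih]
    have hb : ((n:ℝ)+1+1) * (Nat.choose (2*(n+1+1)) (n+1+1)) = 2*(2*((n:ℝ)+1)+1) * (Nat.choose (2*(n+1)) (n+1)) := by
      have := Nat.succ_mul_centralBinom_succ (n+1)
      simp only [Nat.centralBinom] at this
      exact_mod_cast this
    have h1 : (0:ℝ) < (Nat.choose (2*(n+1)) (n+1)) := by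
      exact_mod_cast Nat.choose_pos (by omega)
    push_cast
    rw [hb]
    have h2 := hp (n+1)
    push_cast at h2
    have h3 : (1 - z/(2*((n:ℝ)+1)+1))⁻¹ = (2*((n:ℝ)+1)+1)/(2*((n:ℝ)+1)+1-z) := by
      rw [one_sub_div (by positivity), inv_div]
    have h4 : (1-z)/2 + n + 1 = (2*((n:ℝ)+1)+1-z)/2 := by ring
    rw [h3, h4]
    have e : (2:ℝ)^(2*(n+1+1)) = 4 * 2^(2*(n+1)) := by ring
    rw [e]
    field_simp
    ring

lemma side1 (z : ℝ) (hz : |z| < 1) :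
    HasSum (fun m => (∑' n : ℕ, (2 : ℝ) ^ (2 * (n + 1)) * harmonicNum n *
          modifiedBell (fun k => oddHarmonicPow (n + 1) k) m /
            (((n : ℝ) + 1) ^ 2 * (Nat.choose (2 * (n + 1)) (n + 1)))) * z^m) (SS ((1-z)/2)) := by
  refine swap_lem (fun n m => (2 : ℝ) ^ (2 * (n + 1)) * harmonicNum n *
          modifiedBell (fun k => oddHarmonicPow (n + 1) k) m /
            (((n : ℝ) + 1) ^ 2 * (Nat.choose (2 * (n + 1)) (n + 1)))) ?_
      (fun n z => ss ((1-z)/2) n) (fun z => SS ((1-z)/2)) ?_ ?_ z hz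
  · intro n m
    have := hN_nonneg n
    have := bell_nonneg (fun k => oddHarmonicPow (n + 1) k) (odd_nonneg _) m
    positivity
  · intro z hz n
    obtain ⟨h1, h2⟩ := bell_hasSum (n+1) z hz
    have h3 := h1.of_norm.hasSum
    rw [h2] at h3
    have h4 := h3.mul_left ((2 : ℝ) ^ (2 * (n + 1)) * harmonicNum n / (((n : ℝ) + 1) ^ 2 * (Nat.choose (2 * (n + 1)) (n + 1))))
    convert! h4 using 1
    · funext m; ring
    · unfold ss; rw [← binom_uu n z hz]
      have h1 : (0:ℝ) < (Nat.choose (2*(n+1)) (n+1)) := by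
        exact_mod_cast Nat.choose_pos (by omega)
      field_simp
  · intro z hz
    exact (ss_summable (by linarith [(abs_lt.1 hz).2])).hasSum

lemma side2 (z : ℝ) (hz : |z| < 1) :
    HasSum (fun m : ℕ => (∑' j : ℕ, 4 * ((m:ℝ)+1) * ((m:ℝ)+2) * (1/(2*(j:ℝ)+1)^(m+3))) * z^m)
      (SS ((1-z)/2)) := by
  refine swap_lem (fun j m => 4 * ((m:ℝ)+1) * ((m:ℝ)+2) * (1/(2*(j:ℝ)+1)^(m+3))) ?_
      (fun j z => 1/((1-z)/2+j)^3) (fun z => SS ((1-z)/2)) ?_ ?_ z hz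
  · intro n m; positivity
  · intro z hz j
    have hz1 := (abs_lt.1 hz).2
    have hj : (0:ℝ) ≤ j := by positivity
    have hn : ‖z/(2*(j:ℝ)+1)‖ < 1 := by
      rw [Real.norm_eq_abs, abs_div, abs_of_pos (a := 2*(j:ℝ)+1) (by positivity), div_lt_one (by positivity)]
      linarith
    have h := (hasSum_choose_mul_geometric_of_norm_lt_one 2 hn).mul_left (8/(2*(j:ℝ)+1)^3)
    convert! h using 1
    · funext m
      rw [Nat.cast_choose_two]
      push_cast
      rw [div_pow]
      field_simp
      ring
    · rw [one_sub_div (by positivity), div_pow]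
      have h1 : 0 < 2*(j:ℝ)+1-z := by linarith
      have : (1-z)/2+j = (2*(j:ℝ)+1-z)/2 := by ring
      rw [this]
      field_simp
      norm_num
      ring
  · intro z hz
    exact SS_hasSum (by linarith [(abs_lt.1 hz).2])

lemma zeta_odd (s : ℕ) (hs : 1 < s) :
    riemannZeta s = ((2^s/(2^s-1) * ∑' j : ℕ, 1/(2*(j:ℝ)+1)^s : ℝ) : ℂ) := by
  have hz : riemannZeta s = ((∑' n : ℕ, 1/(n:ℝ)^s : ℝ) : ℂ) := by
    rw [zeta_nat_eq_tsum_of_gt_one hs]; push_cast; rfl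
  rw [hz]
  congr 1
  have hsum : Summable fun n : ℕ => 1/(n:ℝ)^s := Real.summable_one_div_nat_pow.2 hs
  have h1 := tsum_even_add_odd (f := fun n : ℕ => 1/(n:ℝ)^s)
    (hsum.comp_injective (mul_right_injective₀ two_ne_zero))
    (hsum.comp_injective ((add_left_injective 1).comp (mul_right_injective₀ two_ne_zero)))
  have h2 : ∑' k : ℕ, 1/((2*k:ℕ):ℝ)^s = 1/2^s * ∑' n : ℕ, 1/(n:ℝ)^s := by
    rw [← tsum_mul_left]
    congr 1; funext k; push_cast; rw [mul_pow]; ring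
  rw [h2] at h1
  push_cast at h1
  have : (1:ℝ) < 2^s := one_lt_pow₀ (by norm_num) (by omega)
  have h3 : (2:ℝ)^s - 1 ≠ 0 := by linarith
  rw [← h1]
  set T := ∑' n : ℕ, 1/(n:ℝ)^s
  set O := ∑' k : ℕ, 1/(2*(k:ℝ)+1)^s
  have h4 : O = T - 1/2^s * T := by linarith
  rw [h4]
  field_simp
  ring

theorem zeta_eq_sum_central_binom_bell (m : ℕ) :
    riemannZeta (m + 3) =
      ((2 : ℝ) ^ (m + 1) / (((m : ℝ) + 1) * ((m : ℝ) + 2) * ((2 : ℝ) ^ (m + 3) - 1)) *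
        ∑' n : ℕ, (2 : ℝ) ^ (2 * (n + 1)) * harmonicNum n *
          modifiedBell (fun k => oddHarmonicPow (n + 1) k) m /
            (((n : ℝ) + 1) ^ 2 * (Nat.choose (2 * (n + 1)) (n + 1))) : ℝ) := by
  have h := congrFun (uniq_lem _ _ _ side1 side2) m
  have hz := zeta_odd (m+3) (by omega)
  push_cast at hz
  rw [h, hz, tsum_mul_left]
  have : (1:ℝ) < 2^(m+3) := one_lt_pow₀ (by norm_num) (by omega)
  have h3 : (2:ℝ)^(m+3) - 1 ≠ 0 := by linarith
  have e : (2:ℝ)^(m+3) / (2^(m+3)-1) = (2 : ℝ) ^ (m + 1) / (((m : ℝ) + 1) * ((m : ℝ) + 2) * ((2 : ℝ) ^ (m + 3) - 1)) * (4 * ((m:ℝ)+1) * ((m:ℝ)+2)) := by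
    field_simp
    ring
  rw [← mul_assoc, ← e]
  push_cast
  rfl
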